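/- A dyadic subdivision scheme converges (in the sup-norm sense) on every bounded sequence if and only if it converges on the delta sequence δ = (1, 0, 0, ...). -/

import Mathlib

/-- The `n`-th binary digit of a nonnegative real `x` (digit of weight `2^n`). -/
noncomputable def rbit (x : ℝ) (n : ℤ) : ℕ := ⌊x / (2 : ℝ) ^ n⌋.toNat % 2

/-- Dyadic (carry-free, digitwise XOR) addition on the dyadic half-line `ℝ₊`:
the number whose binary digits are the XORs of the binary digits of `x` and `y`.
Since `⊕` is an involution, it coincides with dyadic subtraction `⊖`. -/
noncomputable def dAdd (x y : ℝ) : ℝ :=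
  ∑' n : ℤ, (((rbit x n) ^^^ (rbit y n) : ℕ) : ℝ) * (2 : ℝ) ^ n

/-- `W`-continuity: `f` is continuous with respect to the dyadic metric,
i.e. `f(x ⊕ h) → f(x)` as `h → 0+`, at every point of the half-line. -/
def WCont (f : ℝ → ℝ) : Prop :=
  ∀ x : ℝ, 0 ≤ x → ∀ ε : ℝ, 0 < ε → ∃ δ : ℝ, 0 < δ ∧
    ∀ h : ℝ, 0 ≤ h → h < δ → |f (dAdd x h) - f x| < ε

/-- The dyadic subdivision operator with mask `c` supported on `{0, …, N}`:
`(Sa)(α) = Σ_β c_{α ⊖ 2β} a_β` (the sum is finite since the mask is). -/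
noncomputable def Sop (c : ℕ → ℝ) (N : ℕ) (a : ℕ → ℝ) : ℕ → ℝ :=
  fun α => ∑ β ∈ Finset.range (α + N + 1), c (α ^^^ (2 * β)) * a β

/-- A bounded sequence. -/
def BddSeq (a : ℕ → ℝ) : Prop := ∃ C : ℝ, ∀ k, |a k| ≤ C

/-- The delta sequence `δ = (1, 0, 0, …)`. -/
def deltaSeq : ℕ → ℝ := fun k => if k = 0 then 1 else 0

/-- The dyadic subdivision scheme with mask `c` converges on the sequence `a`
to the `W`-continuous function `f`: `‖f(2⁻ⁿ·) − (Sⁿa)(·)‖_∞ → 0`. -/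
noncomputable def ConvergesTo (c : ℕ → ℝ) (N : ℕ) (a : ℕ → ℝ) (f : ℝ → ℝ) : Prop :=
  WCont f ∧ ∀ ε : ℝ, 0 < ε → ∃ M : ℕ, ∀ n ≥ M, ∀ k : ℕ,
    |f ((2 : ℝ) ^ (-(n : ℤ)) * k) - ((Sop c N)^[n] a) k| < ε

theorem Nat.xor_le_add' (a b : ℕ) : a ^^^ b ≤ a + b := by
  induction a using Nat.strong_induction_on generalizing b with
  | _ a ih =>
    rcases Nat.eq_zero_or_pos a with rfl | ha
    · simp
    · have h₁ := ih (a / 2) (by omega) (b / 2)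
      have h₂ : (a ^^^ b) / 2 = a / 2 ^^^ b / 2 := Nat.xor_div_two
      have h₃ : (a ^^^ b) % 2 = (a + b) % 2 := Nat.xor_mod_two_eq
      omega

theorem Nat.two_pow_mul_xor (n a b : ℕ) :
    2 ^ n * (a ^^^ b) = 2 ^ n * a ^^^ 2 ^ n * b := by
  have h := Nat.shiftLeft_xor_distrib (a := a) (b := b) (i := n)
  simpa only [Nat.shiftLeft_eq, mul_comm] using h

theorem Nat.xor_two_pow_mul_xor_div (n j k : ℕ) :
    k ^^^ 2 ^ n * (j ^^^ k / 2 ^ n) = 2 ^ n * j + k % 2 ^ n := by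
  apply Nat.eq_of_testBit_eq
  intro i
  have h : k % 2 ^ n < 2 ^ n := Nat.mod_lt _ (by positivity)
  rw [Nat.testBit_two_pow_mul_add _ h]
  simp only [Nat.testBit_xor, Nat.testBit_two_pow_mul, Nat.testBit_div_two_pow,
    Nat.testBit_mod_two_pow]
  by_cases hi : i < n
  · simp [hi, Nat.not_le_of_lt hi]
  · have hin : i - n + n = i := by omega
    simp [hi, Nat.le_of_not_lt hi, hin, Bool.xor_comm (k.testBit i)]

/-- Translation of a sequence by `k` with respect to dyadic addition. -/
def dyadicShift (k : ℕ) (a : ℕ → ℝ) : ℕ → ℝ := fun j => a (j ^^^ k)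

section Operator

variable {c : ℕ → ℝ} {N : ℕ}

theorem Sop_eq_tsum (hc : ∀ k, N < k → c k = 0) (a : ℕ → ℝ) (α : ℕ) :
    Sop c N a α = ∑' β, c (α ^^^ (2 * β)) * a β := by
  rw [Sop, tsum_eq_sum]
  intro β hβ
  have hβ : α + N + 1 ≤ β := by simpa using hβ
  have h := Nat.xor_le_add' α (α ^^^ (2 * β))
  rw [← Nat.xor_assoc, Nat.xor_self, Nat.zero_xor] at h
  rw [hc _ (by omega), zero_mul]

theorem Sop_dyadicShift (hc : ∀ k, N < k → c k = 0) (k : ℕ) (a : ℕ → ℝ) :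
    Sop c N (dyadicShift k a) = dyadicShift (2 * k) (Sop c N a) := by
  funext α
  have hinv : Function.Involutive (fun j : ℕ => j ^^^ k) := fun j => by simp
  simp only [dyadicShift, Sop_eq_tsum hc]
  rw [← Equiv.tsum_eq (hinv.toPerm _)]
  refine tsum_congr fun β => ?_
  have h := Nat.two_pow_mul_xor 1 β k
  rw [pow_one] at h
  simp only [Function.Involutive.coe_toPerm, h, Nat.xor_assoc, Nat.xor_self, Nat.xor_zero,
    Nat.xor_comm (2 * k)]

theorem iterate_Sop_dyadicShift (hc : ∀ k, N < k → c k = 0) (n k : ℕ) (a : ℕ → ℝ) :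
    (Sop c N)^[n] (dyadicShift k a) = dyadicShift (2 ^ n * k) ((Sop c N)^[n] a) := by
  induction n generalizing k a with
  | zero => simp
  | succ n ih =>
    rw [Function.iterate_succ_apply, Sop_dyadicShift hc, ih, Function.iterate_succ_apply,
      ← mul_assoc, ← pow_succ]

/-- The subdivision operator as a linear map. -/
noncomputable def SopLinear (c : ℕ → ℝ) (N : ℕ) : Module.End ℝ (ℕ → ℝ) where
  toFun := Sop c N
  map_add' a b := by
    funext α
    simp [Sop, mul_add, Finset.sum_add_distrib]
  map_smul' r a := by
    funext α
    simp [Sop, Finset.mul_sum, mul_left_comm]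

theorem iterate_Sop_eq (n : ℕ) (a : ℕ → ℝ) : (Sop c N)^[n] a = (SopLinear c N ^ n) a := by
  rw [Module.End.pow_apply]
  rfl

theorem iterate_Sop_congr (hc : ∀ k, N < k → c k = 0) {r : ℕ} (hr : N < 2 ^ r) {a b : ℕ → ℝ}
    (n α : ℕ) (hab : ∀ β, β ^^^ α / 2 ^ n < 2 ^ r → a β = b β) :
    (Sop c N)^[n] a α = (Sop c N)^[n] b α := by
  induction n generalizing α with
  | zero =>
    apply hab
    simp
  | succ n ih =>
    simp only [Function.iterate_succ_apply']
    refine Finset.sum_congr rfl fun γ _ => ?_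
    by_cases hγ : N < α ^^^ (2 * γ)
    · rw [hc _ hγ, zero_mul, zero_mul]
    · rw [ih]
      intro β hβ
      apply hab
      have h₁ : α / 2 ^ (n + 1) ^^^ γ / 2 ^ n = (α ^^^ (2 * γ)) / 2 ^ (n + 1) := by
        rw [Nat.xor_div_two_pow, pow_succ', Nat.mul_div_mul_left _ _ two_pos]
      have h₂ : (α ^^^ (2 * γ)) / 2 ^ (n + 1) < 2 ^ r :=
        (Nat.div_le_self _ _).trans_lt (by omega)
      have h₃ := Nat.xor_lt_two_pow hβ (h₁ ▸ h₂)
      rwa [Nat.xor_comm (α / _), Nat.xor_assoc, ← Nat.xor_assoc (γ / _), Nat.xor_self,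
        Nat.zero_xor] at h₃

theorem iterate_Sop_apply (hc : ∀ k, N < k → c k = 0) {r : ℕ} (hr : N < 2 ^ r) (a : ℕ → ℝ)
    (n α : ℕ) :
    (Sop c N)^[n] a α = ∑ j ∈ Finset.range (2 ^ r),
      a (j ^^^ α / 2 ^ n) * (Sop c N)^[n] deltaSeq (2 ^ n * j + α % 2 ^ n) := by
  set m := α / 2 ^ n with hm
  rw [iterate_Sop_congr hc hr (b := ∑ j ∈ Finset.range (2 ^ r),
    a (j ^^^ m) • dyadicShift (j ^^^ m) deltaSeq) n α]
  · rw [iterate_Sop_eq, map_sum, Finset.sum_apply]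
    refine Finset.sum_congr rfl fun j _ => ?_
    rw [map_smul, ← iterate_Sop_eq, iterate_Sop_dyadicShift hc, Pi.smul_apply, smul_eq_mul,
      dyadicShift, Nat.xor_two_pow_mul_xor_div]
  · intro β hβ
    rw [Finset.sum_apply, Finset.sum_eq_single (β ^^^ m)]
    · simp [dyadicShift, deltaSeq]
    · intro j _ hj
      have : β ^^^ (j ^^^ m) ≠ 0 := by
        intro h
        apply hj
        rw [Nat.xor_eq_zero_iff.mp h, Nat.xor_assoc, Nat.xor_self, Nat.xor_zero]
      simp [dyadicShift, deltaSeq, this]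
    · intro h
      exact absurd (Finset.mem_range.mpr hβ) h

end Operator

section Digits

theorem rbit_eq (x : ℝ) (n : ℤ) : rbit x n = ⌊x / (2 : ℝ) ^ n⌋₊ % 2 := by
  rw [rbit, Int.floor_toNat]

theorem rbit_mul_eq_sub (x : ℝ) (n : ℤ) :
    (rbit x n : ℝ) * 2 ^ n =
      (⌊x / (2 : ℝ) ^ n⌋₊ : ℝ) * 2 ^ n - (⌊x / (2 : ℝ) ^ (n + 1)⌋₊ : ℝ) * 2 ^ (n + 1) := by
  have h : ⌊x / (2 : ℝ) ^ (n + 1)⌋₊ = ⌊x / (2 : ℝ) ^ n⌋₊ / 2 := by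
    rw [zpow_add_one₀ two_ne_zero, ← div_div]
    exact_mod_cast Nat.floor_div_natCast (x / (2 : ℝ) ^ n) 2
  have h₂ : (⌊x / (2 : ℝ) ^ n⌋₊ : ℝ)
      = 2 * (⌊x / (2 : ℝ) ^ n⌋₊ / 2 : ℕ) + (⌊x / (2 : ℝ) ^ n⌋₊ % 2 : ℕ) := by
    exact_mod_cast (Nat.div_add_mod _ 2).symm
  rw [h, rbit_eq, zpow_add_one₀ two_ne_zero]
  linear_combination (-(2 : ℝ) ^ n) * h₂

theorem hasSum_rbit {x : ℝ} (hx : 0 ≤ x) : HasSum (fun n : ℤ => (rbit x n : ℝ) * 2 ^ n) x := by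
  set g : ℤ → ℝ := fun n => (⌊x / (2 : ℝ) ^ n⌋₊ : ℝ) * 2 ^ n with hg
  have hf (n : ℤ) : (rbit x n : ℝ) * 2 ^ n = g n - g (n + 1) := rbit_mul_eq_sub x n
  have hnonneg (n : ℤ) : 0 ≤ (rbit x n : ℝ) * 2 ^ n := by positivity
  have hpow : Filter.Tendsto (fun n : ℕ => (2 : ℝ) ^ n) Filter.atTop Filter.atTop :=
    tendsto_pow_atTop_atTop_of_one_lt one_lt_two
  have hpos : HasSum (fun n : ℕ => (rbit x n : ℝ) * 2 ^ (n : ℤ)) (g 0) := by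
    rw [hasSum_iff_tendsto_nat_of_nonneg fun n => hnonneg n]
    have hsum (m : ℕ) : ∑ i ∈ Finset.range m, (rbit x i : ℝ) * 2 ^ (i : ℤ) = g 0 - g m := by
      refine Eq.trans ?_ (Finset.sum_range_sub' (fun i : ℕ => g i) m)
      exact Finset.sum_congr rfl fun i _ => by rw [hf]; norm_cast
    refine tendsto_const_nhds.congr' ?_
    filter_upwards [hpow.eventually_gt_atTop x] with m hm
    have : ⌊x / (2 : ℝ) ^ (m : ℤ)⌋₊ = 0 := by
      rw [Nat.floor_eq_zero, zpow_natCast, div_lt_one (by positivity)]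
      exact hm
    rw [hsum]
    simp only [hg, this, Nat.cast_zero, zero_mul, sub_zero]
  have hneg : HasSum (fun n : ℕ => (rbit x (-(n + 1)) : ℝ) * 2 ^ (-(n + 1) : ℤ)) (x - g 0) := by
    rw [hasSum_iff_tendsto_nat_of_nonneg fun n => hnonneg _]
    have hsum (m : ℕ) : ∑ i ∈ Finset.range m, (rbit x (-(i + 1)) : ℝ) * 2 ^ (-(i + 1) : ℤ)
        = g (-m) - g 0 := by
      have := Finset.sum_range_sub (fun i : ℕ => g (-i)) m
      simp only [Nat.cast_zero, neg_zero] at this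
      rw [← this]
      refine Finset.sum_congr rfl fun i _ => ?_
      rw [hf, Nat.cast_succ, show (-((i : ℤ) + 1) + 1) = -i by ring]
    simp only [hsum]
    refine Filter.Tendsto.sub_const ?_ _
    have := (tendsto_nat_floor_mul_div_atTop hx).comp hpow
    refine this.congr fun m => ?_
    simp [hg, div_eq_mul_inv]
  have := HasSum.of_nat_of_neg_add_one (f := fun n : ℤ => (rbit x n : ℝ) * 2 ^ n) hpos hneg
  rwa [add_sub_cancel] at this

theorem rbit_of_lt_one {t : ℝ} (ht : t < 1) (n : ℕ) : rbit t n = 0 := by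
  have : ⌊t / (2 : ℝ) ^ (n : ℤ)⌋₊ = 0 := by
    rw [Nat.floor_eq_zero, zpow_natCast, div_lt_one (by positivity)]
    exact ht.trans_le (one_le_pow₀ one_le_two)
  rw [rbit_eq, this]

theorem rbit_natCast_add (m n : ℕ) {t : ℝ} (ht : 0 ≤ t) (ht1 : t < 1) :
    rbit (m + t) n = rbit m n := by
  have h (y : ℝ) : ⌊y / (2 : ℝ) ^ (n : ℤ)⌋₊ = ⌊y⌋₊ / 2 ^ n := by
    have := Nat.floor_div_natCast y (2 ^ n)
    rw [zpow_natCast]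
    exact_mod_cast this
  rw [rbit_eq, rbit_eq, h, h, add_comm, Nat.floor_add_natCast ht, Nat.floor_eq_zero.mpr ht1,
    Nat.floor_natCast, zero_add]

theorem rbit_natCast_add_neg (m n : ℕ) {t : ℝ} (ht : 0 ≤ t) :
    rbit (m + t) (-(n + 1)) = rbit t (-(n + 1)) := by
  have h (y : ℝ) : y / (2 : ℝ) ^ (-(n + 1) : ℤ) = y * 2 ^ (n + 1) := by
    rw [zpow_neg, div_inv_eq_mul]
    norm_cast
  rw [rbit_eq, rbit_eq, h, h, add_mul, add_comm,
    show (m : ℝ) * 2 ^ (n + 1) = ((2 * (m * 2 ^ n) : ℕ) : ℝ) by push_cast; ring,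
    Nat.floor_add_natCast (by positivity), Nat.add_mul_mod_self_left]

theorem rbit_natCast_neg (m n : ℕ) : rbit m (-(n + 1)) = 0 := by
  simpa [rbit] using rbit_natCast_add_neg m n le_rfl

theorem dAdd_term_le (x y : ℝ) (n : ℤ) :
    ((rbit x n ^^^ rbit y n : ℕ) : ℝ) * 2 ^ n ≤
      (rbit x n : ℝ) * 2 ^ n + (rbit y n : ℝ) * 2 ^ n := by
  rw [← add_mul]
  gcongr
  exact_mod_cast Nat.xor_le_add' _ _

theorem hasSum_dAdd {x y : ℝ} (hx : 0 ≤ x) (hy : 0 ≤ y) :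
    HasSum (fun n : ℤ => ((rbit x n ^^^ rbit y n : ℕ) : ℝ) * 2 ^ n) (dAdd x y) :=
  (Summable.of_nonneg_of_le (fun _ => by positivity) (dAdd_term_le x y)
    ((hasSum_rbit hx).add (hasSum_rbit hy)).summable).hasSum

theorem dAdd_nonneg (x y : ℝ) : 0 ≤ dAdd x y :=
  tsum_nonneg fun _ => by positivity

theorem dAdd_le_add {x y : ℝ} (hx : 0 ≤ x) (hy : 0 ≤ y) : dAdd x y ≤ x + y :=
  hasSum_le (dAdd_term_le x y) (hasSum_dAdd hx hy) ((hasSum_rbit hx).add (hasSum_rbit hy))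

theorem dAdd_natCast_add (m : ℕ) {t h : ℝ} (ht : 0 ≤ t) (ht1 : t < 1) (hh : 0 ≤ h)
    (hh1 : h < 1) : dAdd (m + t) h = m + dAdd t h := by
  refine (hasSum_dAdd (by positivity) hh).unique ?_
  convert (hasSum_rbit (Nat.cast_nonneg m)).add (hasSum_dAdd ht hh) using 2 with n
  rcases n with n | n
  · simp [rbit_natCast_add m n ht ht1, rbit_of_lt_one ht1, rbit_of_lt_one hh1]
  · rw [Int.negSucc_eq, rbit_natCast_add_neg m n ht, rbit_natCast_neg, Nat.cast_zero, zero_mul,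
      zero_add]

end Digits

open Filter Topology in
theorem wCont_iff_tendsto {f : ℝ → ℝ} :
    WCont f ↔ ∀ x : ℝ, 0 ≤ x → Tendsto (fun h => f (dAdd x h)) (𝓝[≥] 0) (𝓝 (f x)) := by
  refine forall₂_congr fun x _ => ?_
  rw [Metric.tendsto_nhdsWithin_nhds]
  refine forall₂_congr fun ε _ => exists_congr fun δ => and_congr_right fun _ => ?_
  refine forall_congr' fun h => forall_congr' fun hh => ?_
  rw [Real.dist_eq, Real.dist_eq, sub_zero, abs_of_nonneg hh]

/-- The limit function generated by `a` from the limit function `φ` of the delta sequence,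
where `K` bounds the support of `φ`. -/
noncomputable def dyadicSynthesis (K : ℕ) (a : ℕ → ℝ) (φ : ℝ → ℝ) (x : ℝ) : ℝ :=
  ∑ j ∈ Finset.range K, a (j ^^^ ⌊x⌋₊) * φ (j + (x - ⌊x⌋₊))

open Filter Topology in
theorem WCont.dyadicSynthesis {φ : ℝ → ℝ} (hφ : WCont φ) (K : ℕ) (a : ℕ → ℝ) :
    WCont (dyadicSynthesis K a φ) := by
  rw [wCont_iff_tendsto] at hφ ⊢
  intro x hx
  set m := ⌊x⌋₊ with hm
  set t := x - m with ht
  have ht0 : 0 ≤ t := sub_nonneg.mpr (Nat.floor_le hx)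
  have ht1 : t < 1 := by
    have := Nat.lt_floor_add_one x
    linarith
  have hlim : Tendsto (fun h => ∑ j ∈ Finset.range K, a (j ^^^ m) * φ (dAdd (j + t) h)) (𝓝[≥] 0)
      (𝓝 (_root_.dyadicSynthesis K a φ x)) :=
    tendsto_finsetSum _ fun j _ => (hφ (j + t) (by positivity)).const_mul _
  refine hlim.congr' ?_
  filter_upwards [self_mem_nhdsWithin,
    mem_nhdsWithin_of_mem_nhds (Iio_mem_nhds (sub_pos.mpr ht1))] with h hh0 hh
  have hh0 : 0 ≤ h := hh0
  have hh : h < 1 - t := hh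
  have hd : dAdd x h = m + dAdd t h := by
    rw [← dAdd_natCast_add m ht0 ht1 hh0 (by linarith), ht, add_sub_cancel]
  have hd1 : dAdd t h < 1 := (dAdd_le_add ht0 hh0).trans_lt (by linarith)
  have hfloor : ⌊dAdd x h⌋₊ = m := by
    rw [hd, add_comm, Nat.floor_add_natCast (dAdd_nonneg _ _), Nat.floor_eq_zero.mpr hd1,
      zero_add]
  refine Finset.sum_congr rfl fun j _ => ?_
  rw [hfloor, hd, add_sub_cancel_left, dAdd_natCast_add j ht0 ht1 hh0 (by linarith)]

theorem dyadicSynthesis_dyadic (K : ℕ) (a : ℕ → ℝ) (φ : ℝ → ℝ) (n k : ℕ) :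
    dyadicSynthesis K a φ ((2 : ℝ) ^ (-(n : ℤ)) * k) = ∑ j ∈ Finset.range K,
      a (j ^^^ k / 2 ^ n) * φ ((2 : ℝ) ^ (-(n : ℤ)) * (2 ^ n * j + k % 2 ^ n : ℕ)) := by
  have hfloor : ⌊(2 : ℝ) ^ (-(n : ℤ)) * k⌋₊ = k / 2 ^ n := by
    rw [zpow_neg, zpow_natCast, inv_mul_eq_div]
    exact_mod_cast Nat.floor_div_eq_div (K := ℝ) k (2 ^ n)
  have hk : (k : ℝ) = 2 ^ n * (k / 2 ^ n : ℕ) + (k % 2 ^ n : ℕ) := by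
    exact_mod_cast (Nat.div_add_mod k (2 ^ n)).symm
  rw [dyadicSynthesis, hfloor]
  refine Finset.sum_congr rfl fun j _ => ?_
  congr 2
  rw [hk, zpow_neg, zpow_natCast, ← hk]
  push_cast
  nth_rewrite 1 [hk]
  field_simp
  ring

/-- A dyadic subdivision scheme converges on every bounded sequence
if and only if it converges on the delta sequence. -/
theorem scheme_converges_iff_converges_on_delta
    (c : ℕ → ℝ) (N : ℕ) (hc : ∀ k, N < k → c k = 0) :
    (∀ a : ℕ → ℝ, BddSeq a → ∃ f : ℝ → ℝ, ConvergesTo c N a f) ↔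
      (∃ f : ℝ → ℝ, ConvergesTo c N deltaSeq f) := by
  constructor
  · refine fun h => h deltaSeq ⟨1, fun k => ?_⟩
    unfold deltaSeq
    split_ifs <;> simp
  rintro ⟨φ, hφ, hconv⟩ a ⟨C, hC⟩
  have hr : N < 2 ^ N := Nat.lt_two_pow_self
  have hC0 : 0 ≤ C := (abs_nonneg _).trans (hC 0)
  refine ⟨dyadicSynthesis (2 ^ N) a φ, hφ.dyadicSynthesis _ a, fun ε hε => ?_⟩
  set B : ℝ := 2 ^ N * (C + 1) with hB
  have hB0 : 0 < B := by positivity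
  obtain ⟨M, hM⟩ := hconv (ε / B) (by positivity)
  refine ⟨M, fun n hn k => ?_⟩
  rw [dyadicSynthesis_dyadic, iterate_Sop_apply hc hr, ← Finset.sum_sub_distrib]
  simp only [← mul_sub]
  refine (Finset.abs_sum_le_sum_abs _ _).trans_lt ?_
  calc _ < ∑ _j ∈ Finset.range (2 ^ N), (C + 1) * (ε / B) := by
        refine Finset.sum_lt_sum_of_nonempty (by simp) fun j _ => ?_
        rw [abs_mul]
        exact mul_lt_mul'' ((hC _).trans_lt (lt_add_one C)) (hM n hn _) (abs_nonneg _)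
          (abs_nonneg _)
    _ = ε := by
        rw [Finset.sum_const, Finset.card_range, nsmul_eq_mul, Nat.cast_pow, Nat.cast_ofNat,
          ← mul_assoc, ← hB, mul_div_cancel₀ _ hB0.ne']
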